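/- arXiv:1606.08077 — 3 statements merged into one kernel-verified Lean document; each statement's English description precedes it below -/
import Mathlib

section
/- Assume that there are n players with monotonic preferences ≽_1,…,≽_n on the subsets of a set S of m items. Then there exists a subset T ⊆ S with |T| ≤ min(⌈(m+n−1)/2⌉, m) such that T is agreeable to all n players, i.e., T ≽_i S∖T for every i ∈ {1,…,n}. -/
open Finset

/-- A preference on subsets: a complete (total, hence reflexive) and transitive relation. -/
def IsPref {m : ℕ} (R : Finset (Fin m) → Finset (Fin m) → Prop) : Prop :=
  (∀ A B, R A B ∨ R B A) ∧ ∀ A B C, R A B → R B C → R A C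

/-- A preference on single items: a complete and transitive relation. -/
def IsSingPref {m : ℕ} (Rs : Fin m → Fin m → Prop) : Prop :=
  (∀ x y, Rs x y ∨ Rs y x) ∧ ∀ x y z, Rs x y → Rs y z → Rs x z

/-- A preference is monotonic if `T ∪ {x} ≽ T` for every subset `T` and item `x`. -/
def MonotonicPref {m : ℕ} (R : Finset (Fin m) → Finset (Fin m) → Prop) : Prop :=
  ∀ (T : Finset (Fin m)) (x : Fin m), R (insert x T) T

/-- A preference on subsets is responsive w.r.t. a preference `Rs` on single items if it is
monotonic and `(T \ {y}) ∪ {x} ≽ T` whenever `x ∉ T`, `y ∈ T` and `x ≽ˢ y`. -/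
def Responsive {m : ℕ} (Rs : Fin m → Fin m → Prop)
    (R : Finset (Fin m) → Finset (Fin m) → Prop) : Prop :=
  MonotonicPref R ∧
    ∀ (T : Finset (Fin m)) (x y : Fin m),
      x ∉ T → y ∈ T → Rs x y → R (insert x (T.erase y)) T

/-- A preference on subsets is consistent with a preference on single items if its
restriction to singletons agrees with it. -/
def Consistent {m : ℕ} (Rs : Fin m → Fin m → Prop)
    (R : Finset (Fin m) → Finset (Fin m) → Prop) : Prop :=
  ∀ x y : Fin m, R {x} {y} ↔ Rs x y

/-- `T` is necessarily agreeable w.r.t. `Rs` if `T ≽ Tᶜ` for every responsive preference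
consistent with `Rs`. -/
def NecAgreeable {m : ℕ} (Rs : Fin m → Fin m → Prop) (T : Finset (Fin m)) : Prop :=
  ∀ R : Finset (Fin m) → Finset (Fin m) → Prop,
    IsPref R → Responsive Rs R → Consistent Rs R → R T Tᶜ

/-- `T` is possibly agreeable w.r.t. `Rs` if `T ≻ Tᶜ` for some responsive preference
consistent with `Rs`. -/
def PossAgreeable {m : ℕ} (Rs : Fin m → Fin m → Prop) (T : Finset (Fin m)) : Prop :=
  ∃ R : Finset (Fin m) → Finset (Fin m) → Prop,
    IsPref R ∧ Responsive Rs R ∧ Consistent Rs R ∧ R T Tᶜ ∧ ¬ R Tᶜ T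


/-- signs alternate along the list, starting with the given sign -/
def altS : Bool → List (ℕ × Bool) → Bool
  | _, [] => true
  | s, a :: l => (a.2 == s) && altS (!s) l

/-- opposite label -/
def negL (a : ℕ × Bool) : ℕ × Bool := (a.1, !a.2)

/-- the multiset is alternating when sorted by absolute value -/
def AltM (s : Bool) (M : Multiset (ℕ × Bool)) : Prop :=
  ∃ l : List (ℕ × Bool), (l : Multiset (ℕ × Bool)) = M ∧
    l.Pairwise (fun a b => a.1 < b.1) ∧ altS s l = true

open Classical in
/-- indicator of `AltM` -/
noncomputable def FM (s : Bool) (M : Multiset (ℕ × Bool)) : ZMod 2 := if AltM s M then 1 else 0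

theorem altS_neg (s : Bool) (l : List (ℕ × Bool)) : altS s (l.map negL) = altS (!s) l := by
  induction l generalizing s with
  | nil => rfl
  | cons a l ih =>
    simp only [List.map_cons, altS, ih, negL]
    cases s <;> cases a.2 <;> simp

theorem AltM_neg_imp (s : Bool) (M : Multiset (ℕ × Bool)) (h : AltM s M) :
    AltM (!s) (M.map negL) := by
  obtain ⟨l, rfl, h1, h2⟩ := h
  refine ⟨l.map negL, by simp, ?_, ?_⟩
  · rw [List.pairwise_map]; exact h1
  · rw [altS_neg]; simpa using h2

theorem FM_neg (s : Bool) (M : Multiset (ℕ × Bool)) : FM s (M.map negL) = FM (!s) M := by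
  have : AltM s (M.map negL) ↔ AltM (!s) M := by
    constructor
    · intro h
      have := AltM_neg_imp _ _ h
      have h2 : (negL ∘ negL) = id := by funext a; simp [negL]
      rwa [Multiset.map_map, h2, Multiset.map_id] at this
    · intro h
      simpa using AltM_neg_imp _ _ h
  unfold FM
  by_cases h : AltM (!s) M
  · rw [if_pos h, if_pos (this.2 h)]
  · rw [if_neg h, if_neg (fun h' => h (this.1 h'))]

theorem AltM_coe (s : Bool) (l : List (ℕ × Bool)) (hl : l.Pairwise (fun a b => a.1 < b.1)) :
    AltM s (l : Multiset (ℕ × Bool)) ↔ altS s l = true := by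
  constructor
  · rintro ⟨l', h, h1, h2⟩
    have hp : l'.Perm l := Multiset.coe_eq_coe.1 h
    have : l' = l := hp.eq_of_pairwise (fun a b _ _ h1 h2 => absurd h1 (by omega)) h1 hl
    rw [← this]; exact h2
  · intro h; exact ⟨l, rfl, hl, h⟩

/-- boolean to ZMod 2 -/
def bz (b : Bool) : ZMod 2 := if b then 1 else 0

theorem FM_coe (s : Bool) (l : List (ℕ × Bool)) (hl : l.Pairwise (fun a b => a.1 < b.1)) :
    FM s (l : Multiset (ℕ × Bool)) = bz (altS s l) := by
  simp only [FM, AltM_coe s l hl, bz]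

theorem sum_list (s : Bool) (l : List (ℕ × Bool)) (hl : l.Pairwise (fun a b => a.1 < b.1)) :
    (l.map (fun a => bz (altS s (l.erase a)))).sum = bz (altS s l) + bz (altS (!s) l) := by
  induction l generalizing s with
  | nil => simp [altS, bz]; decide
  | cons a t ih =>
    rw [List.pairwise_cons] at hl
    have h1 : t.map (fun b => bz (altS s ((a :: t).erase b))) =
        t.map (fun b => bz (a.2 == s) * bz (altS (!s) (t.erase b))) := by
      apply List.map_congr_left
      intro b hb
      have hne : a ≠ b := by
        rintro rfl; exact absurd (hl.1 _ hb) (by omega)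
      rw [List.erase_cons_tail (by simpa using hne)]
      simp only [altS]
      generalize (a.2 == s) = u
      generalize altS (!s) (t.erase b) = v
      revert u v; decide
    rw [List.map_cons, List.sum_cons, h1, List.sum_map_mul_left, ih (!s) hl.2]
    simp only [List.erase_cons_head, altS, Bool.not_not]
    generalize altS (!s) t = u
    generalize altS s t = v
    generalize a.2 = w
    clear ih h1; revert s u v w; decide

theorem FM_not_nodup (s : Bool) (M : Multiset (ℕ × Bool)) (h : ¬ M.Nodup) : FM s M = 0 := by
  unfold FM
  rw [if_neg]
  rintro ⟨l, rfl, h1, -⟩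
  apply h
  rw [Multiset.coe_nodup]
  exact h1.imp (fun {a b} hab => by rintro rfl; omega)

theorem sum_mset (s : Bool) (M : Multiset (ℕ × Bool))
    (hM : ∀ a ∈ M, ∀ b ∈ M, b ≠ negL a) :
    (M.map (fun a => FM s (M.erase a))).sum = FM s M + FM (!s) M := by
  by_cases hn : M.Nodup
  · have hn' : (M.map Prod.fst).Nodup := by
      apply Multiset.Nodup.map_on _ hn
      intro a ha b hb hab
      by_contra hne
      apply hM a ha b hb
      obtain ⟨a1, a2⟩ := a
      obtain ⟨b1, b2⟩ := b
      simp only at hab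
      subst hab
      cases a2 <;> cases b2 <;> simp_all [negL]
    obtain ⟨l, rfl, hl⟩ : ∃ l : List (ℕ × Bool), (l : Multiset (ℕ × Bool)) = M ∧
        l.Pairwise (fun a b => a.1 < b.1) := by
      induction M using Quotient.inductionOn with
      | h l0 =>
      refine ⟨l0.insertionSort (fun a b => a.1 ≤ b.1), ?_, ?_⟩
      · exact Multiset.coe_eq_coe.2 (List.perm_insertionSort _ _)
      · have : Std.Total (fun a b : ℕ × Bool => a.1 ≤ b.1) := ⟨fun a b => le_total _ _⟩
        have : IsTrans (ℕ × Bool) (fun a b : ℕ × Bool => a.1 ≤ b.1) :=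
          ⟨fun a b c h1 h2 => le_trans h1 h2⟩
        have h1 := List.pairwise_insertionSort (fun a b : ℕ × Bool => a.1 ≤ b.1) l0
        have h2 : (l0.map Prod.fst).Nodup := by simpa using hn'
        have h3 : ((l0.insertionSort (fun a b => a.1 ≤ b.1)).map Prod.fst).Nodup :=
          ((List.perm_insertionSort (fun a b : ℕ × Bool => a.1 ≤ b.1) l0).map Prod.fst).nodup_iff.2 h2
        rw [List.Nodup, List.pairwise_map] at h3
        exact h1.imp₂ (fun a b h h' => lt_of_le_of_ne h h') h3
    rw [FM_coe _ _ hl, FM_coe _ _ hl, ← sum_list s l hl, Multiset.map_coe, Multiset.sum_coe]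
    congr 1
    apply List.map_congr_left
    intro a _
    have hb : (instBEqOfDecidableEq : BEq (ℕ × Bool)) = instBEqProd :=
      lawful_beq_subsingleton _ _
    rw [Multiset.coe_erase, hb]
    exact FM_coe _ _ (hl.sublist List.erase_sublist)
  · rw [FM_not_nodup _ _ hn, FM_not_nodup _ _ hn]
    rw [Multiset.nodup_iff_le] at hn
    push Not at hn
    obtain ⟨a, ha⟩ := hn
    obtain ⟨M', rfl⟩ := Multiset.le_iff_exists_add.1 ha
    have e : (a ::ₘ a ::ₘ 0) + M' = a ::ₘ a ::ₘ M' := by simp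
    rw [e]
    have h0 : (M'.map (fun b => FM s ((a ::ₘ a ::ₘ M').erase b))) = M'.map (fun _ => 0) := by
      apply Multiset.map_congr rfl
      intro b hb
      apply FM_not_nodup
      by_cases hab : b = a
      · subst hab
        rw [Multiset.erase_cons_head]
        simp [hb]
      · rw [Multiset.erase_cons_tail _ (Ne.symm hab), Multiset.erase_cons_tail _ (Ne.symm hab)]
        simp
    rw [Multiset.map_cons, Multiset.map_cons, Multiset.sum_cons, Multiset.sum_cons, h0]
    simp only [Multiset.erase_cons_head, Multiset.map_const', Multiset.sum_replicate, smul_zero,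
      add_zero]
    exact CharTwo.add_self_eq_zero _

theorem sum_idx (s : Bool) (I : Finset ℕ) (g : ℕ → ℕ × Bool)
    (hM : ∀ i ∈ I, ∀ j ∈ I, g j ≠ negL (g i)) :
    ∑ i ∈ I, FM s ((I.erase i).val.map g) = FM s (I.val.map g) + FM (!s) (I.val.map g) := by
  rw [← sum_mset]
  · rw [Multiset.map_map, Finset.sum]
    congr 1
    apply Multiset.map_congr rfl
    intro i hi
    simp only [Function.comp]
    rw [Finset.erase_val, Multiset.map_erase_of_mem _ _ hi]
  · intro a ha b hb
    obtain ⟨i, hi, rfl⟩ := Multiset.mem_map.1 ha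
    obtain ⟨j, hj, rfl⟩ := Multiset.mem_map.1 hb
    exact hM i hi j hj

section tucker
variable {n : ℕ}

/-- positive part of the i-th chain element -/
def posP (π : Equiv.Perm (Fin n)) (s : Fin n → Bool) (i : ℕ) : Finset (Fin n) :=
  Finset.univ.filter (fun x => (π x : ℕ) ≤ i ∧ s x = true)

/-- negative part of the i-th chain element -/
def negP (π : Equiv.Perm (Fin n)) (s : Fin n → Bool) (i : ℕ) : Finset (Fin n) :=
  Finset.univ.filter (fun x => (π x : ℕ) ≤ i ∧ s x = false)

/-- label of the i-th chain element -/
def lab (lam : Finset (Fin n) → Finset (Fin n) → ℕ × Bool)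
    (p : Equiv.Perm (Fin n) × (Fin n → Bool)) (i : ℕ) : ℕ × Bool :=
  lam (posP p.1 p.2 i) (negP p.1 p.2 i)

/-- permutations fixing positions from d on, signs positive from e on -/
def QS (n d e : ℕ) : Finset (Equiv.Perm (Fin n) × (Fin n → Bool)) :=
  Finset.univ.filter (fun p => (∀ x : Fin n, d ≤ (x : ℕ) → p.1 x = x) ∧
    ∀ x : Fin n, e ≤ (x : ℕ) → p.2 x = true)

theorem mem_QS (d e : ℕ) (p : Equiv.Perm (Fin n) × (Fin n → Bool)) : p ∈ QS n d e ↔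
    (∀ x : Fin n, d ≤ (x : ℕ) → p.1 x = x) ∧ ∀ x : Fin n, e ≤ (x : ℕ) → p.2 x = true := by
  simp [QS]

variable (lam : Finset (Fin n) → Finset (Fin n) → ℕ × Bool)

theorem lab_congr (p p' : Equiv.Perm (Fin n) × (Fin n → Bool)) (i : ℕ)
    (h1 : ∀ x, (p.1 x : ℕ) ≤ i ↔ (p'.1 x : ℕ) ≤ i)
    (h2 : ∀ x, (p.1 x : ℕ) ≤ i → p.2 x = p'.2 x) : lab lam p i = lab lam p' i := by
  unfold lab posP negP
  congr 1 <;> (ext x; have := h1 x; have := h2 x; simp only [Finset.mem_filter]; grind)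

theorem FM_congr (p p' : Equiv.Perm (Fin n) × (Fin n → Bool)) (I : Finset ℕ) (b : Bool)
    (h : ∀ i ∈ I, lab lam p i = lab lam p' i) :
    FM b (I.val.map (lab lam p)) = FM b (I.val.map (lab lam p')) := by
  congr 1
  exact Multiset.map_congr rfl h

/-- the number (mod 2) of alternating chains -/
noncomputable def aN (d : ℕ) : ZMod 2 :=
  ∑ p ∈ QS n d d, FM true ((Finset.range d).val.map (lab lam p))

theorem fix_lt {d : ℕ} {π : Equiv.Perm (Fin n)} (h : ∀ x : Fin n, d ≤ (x : ℕ) → π x = x)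
    (x : Fin n) : (π x : ℕ) < d ↔ (x : ℕ) < d := by
  constructor
  · intro hx
    by_contra hc
    rw [h x (by omega)] at hx
    omega
  · intro hx
    by_contra hc
    have := π.injective (h (π x) (by omega))
    rw [this] at hc
    omega

theorem sum_swap (d i : ℕ) (hd : d < n) (hi : i < d) :
    ∑ p ∈ QS n (d + 1) d, FM true (((Finset.range (d + 1)).erase i).val.map (lab lam p)) = 0 := by
  let a : Fin n := ⟨i, by omega⟩
  let b : Fin n := ⟨i + 1, by omega⟩
  have hab : a ≠ b := by simp [a, b]
  refine Finset.sum_involution (fun p _ => (Equiv.swap a b * p.1, p.2)) ?_ ?_ ?_ ?_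
  · intro p hp
    rw [FM_congr lam (Equiv.swap a b * p.1, p.2) p]
    · exact CharTwo.add_self_eq_zero _
    · intro j hj
      have hj : j ≠ i := (Finset.mem_erase.1 hj).1
      apply lab_congr
      · intro x
        simp only [Equiv.Perm.mul_apply]
        by_cases h1 : p.1 x = a
        · rw [h1, Equiv.swap_apply_left]; simp only [a, b]; omega
        · by_cases h2 : p.1 x = b
          · rw [h2, Equiv.swap_apply_right]; simp only [a, b]; omega
          · rw [Equiv.swap_apply_of_ne_of_ne h1 h2]
      · intro x _; rfl
  · intro p hp _ h
    have h1 := congrArg Prod.fst h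
    simp only at h1
    have h2 : Equiv.swap a b = 1 := by simpa using h1
    exact hab (Equiv.swap_eq_one_iff.1 h2)
  · intro p hp
    rw [mem_QS] at hp ⊢
    refine ⟨fun x hx => ?_, hp.2⟩
    simp only [Equiv.Perm.mul_apply]
    rw [hp.1 x hx]
    apply Equiv.swap_apply_of_ne_of_ne
    · intro h; rw [h] at hx; simp only [a] at hx; omega
    · intro h; rw [h] at hx; simp only [b] at hx; omega
  · intro p hp
    ext <;> simp

theorem sum_top (d : ℕ) (hd : d < n) :
    ∑ p ∈ QS n (d + 1) d, FM true (((Finset.range (d + 1)).erase d).val.map (lab lam p)) =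
      aN lam d := by
  have he : (Finset.range (d + 1)).erase d = Finset.range d := by
    ext; simp; omega
  rw [he]
  let D : Fin n := ⟨d, hd⟩
  rw [← Finset.sum_filter_add_sum_filter_not _ (fun p => p.1 D = D)]
  have h1 : (QS n (d + 1) d).filter (fun p => p.1 D = D) = QS n d d := by
    ext p
    rw [Finset.mem_filter, mem_QS, mem_QS]
    constructor
    · rintro ⟨⟨h1, h2⟩, h3⟩
      refine ⟨fun x hx => ?_, h2⟩
      by_cases hxd : (x : ℕ) = d
      · have : x = D := Fin.ext hxd
        rw [this, h3]
      · exact h1 x (by omega)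
    · rintro ⟨h1, h2⟩
      exact ⟨⟨fun x hx => h1 x (by omega), h2⟩, h1 D le_rfl⟩
  rw [h1]
  have h2 : ∑ p ∈ (QS n (d + 1) d).filter (fun p => ¬ p.1 D = D),
      FM true ((Finset.range d).val.map (lab lam p)) = 0 := by
    refine Finset.sum_involution (fun p _ => (p.1,
      fun x => if p.1 x = D then !(p.2 x) else p.2 x)) ?_ ?_ ?_ ?_
    · intro p hp
      rw [FM_congr lam (p.1, fun x => if p.1 x = D then !(p.2 x) else p.2 x) p]
      · exact CharTwo.add_self_eq_zero _
      · intro j hj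
        have hj : j < d := Finset.mem_range.1 hj
        apply lab_congr
        · intro x; rfl
        · intro x hx
          simp only at hx ⊢
          rw [if_neg]
          intro h
          rw [h] at hx
          simp only [D] at hx; omega
    · intro p hp _ h
      have h1 := congrFun (congrArg Prod.snd h) (p.1.symm D)
      simp at h1
    · intro p hp
      rw [Finset.mem_filter, mem_QS] at hp ⊢
      refine ⟨⟨hp.1.1, fun x hx => ?_⟩, hp.2⟩
      simp only
      rw [if_neg, hp.1.2 x hx]
      intro h
      by_cases hxd : (x : ℕ) = d
      · have : x = D := Fin.ext hxd
        rw [this] at h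
        exact hp.2 h
      · rw [hp.1.1 x (by omega)] at h
        exact hxd (congrArg Fin.val h)
    · intro p hp
      ext x
      · rfl
      · simp only
        split_ifs <;> simp
  rw [h2, add_zero]
  rfl

theorem chain_mem (p : Equiv.Perm (Fin n) × (Fin n → Bool)) (i : ℕ) (hn : 0 < n) :
    Disjoint (posP p.1 p.2 i) (negP p.1 p.2 i) ∧ (posP p.1 p.2 i ∪ negP p.1 p.2 i).Nonempty := by
  constructor
  · rw [Finset.disjoint_left]
    intro x hx hx'
    simp only [posP, negP, Finset.mem_filter] at hx hx'
    rw [hx.2.2] at hx'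
    exact absurd hx'.2.2 (by decide)
  · refine ⟨p.1.symm ⟨0, hn⟩, ?_⟩
    simp only [posP, negP, Finset.mem_union, Finset.mem_filter]
    cases p.2 (p.1.symm ⟨0, hn⟩) <;> simp

theorem aN_step
    (hanti : ∀ A B, Disjoint A B → (A ∪ B).Nonempty → lam B A = negL (lam A B))
    (hcomp : ∀ A B A' B', Disjoint A B → (A ∪ B).Nonempty → Disjoint A' B' → A ⊆ A' → B ⊆ B' →
      lam A' B' ≠ negL (lam A B))
    (d : ℕ) (hd : d < n) : aN lam (d + 1) = aN lam d := by
  let D : Fin n := ⟨d, hd⟩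
  rw [← sum_top lam d hd]
  have key : ∑ p ∈ QS n (d + 1) d, (FM true ((Finset.range (d + 1)).val.map (lab lam p)) +
      FM false ((Finset.range (d + 1)).val.map (lab lam p))) =
      ∑ p ∈ QS n (d + 1) d, FM true (((Finset.range (d + 1)).erase d).val.map (lab lam p)) := by
    have : ∀ p ∈ QS n (d + 1) d, (FM true ((Finset.range (d + 1)).val.map (lab lam p)) +
      FM false ((Finset.range (d + 1)).val.map (lab lam p))) =
        ∑ i ∈ Finset.range (d + 1),
          FM true (((Finset.range (d + 1)).erase i).val.map (lab lam p)) := by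
      intro p _
      rw [sum_idx]
      · rfl
      · have hmono : ∀ i j, i ≤ j → lab lam p j ≠ negL (lab lam p i) := by
          intro i j hij
          obtain ⟨c1, c2⟩ := chain_mem p i (by omega)
          obtain ⟨c3, c4⟩ := chain_mem p j (by omega)
          apply hcomp _ _ _ _ c1 c2 c3
          · intro x; simp only [posP, Finset.mem_filter]; grind
          · intro x; simp only [negP, Finset.mem_filter]; grind
        intro i _ j _
        rcases le_total i j with h | h
        · exact hmono i j h
        · intro h'
          apply hmono j i h
          rw [h']; simp [negL]
    rw [Finset.sum_congr rfl this, Finset.sum_comm, Finset.sum_range_succ,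
      Finset.sum_eq_zero, zero_add]
    intro i hi
    exact sum_swap lam d i hd (Finset.mem_range.1 hi)
  rw [← key, Finset.sum_add_distrib]
  unfold aN
  rw [← Finset.sum_filter_add_sum_filter_not _ (fun p => p.2 D = true)]
  have h1 : (QS n (d + 1) (d + 1)).filter (fun p => p.2 D = true) = QS n (d + 1) d := by
    ext p
    rw [Finset.mem_filter, mem_QS, mem_QS]
    constructor
    · rintro ⟨⟨h1, h2⟩, h3⟩
      refine ⟨h1, fun x hx => ?_⟩
      by_cases hxd : (x : ℕ) = d
      · have : x = D := Fin.ext hxd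
        rw [this, h3]
      · exact h2 x (by omega)
    · rintro ⟨h1, h2⟩
      exact ⟨⟨h1, fun x hx => h2 x (by omega)⟩, h2 D le_rfl⟩
  rw [h1]
  congr 1
  let fl : Equiv.Perm (Fin n) × (Fin n → Bool) → Equiv.Perm (Fin n) × (Fin n → Bool) :=
    fun p => (p.1, fun x => if (x : ℕ) ≤ d then !(p.2 x) else p.2 x)
  have hfl : ∀ p, fl (fl p) = p := by
    intro p
    ext x
    · rfl
    · simp only [fl]
      split_ifs <;> simp
  refine Finset.sum_bij' (fun p _ => fl p) (fun p _ => fl p) ?_ ?_ ?_ ?_ ?_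
  · intro p hp
    rw [Finset.mem_filter, mem_QS] at hp
    rw [mem_QS]
    refine ⟨hp.1.1, fun x hx => ?_⟩
    simp only [fl]
    by_cases hxd : (x : ℕ) = d
    · have : x = D := Fin.ext hxd
      rw [if_pos hxd.le, this]
      simpa using hp.2
    · rw [if_neg (by omega)]
      exact hp.1.2 x (by omega)
  · intro p hp
    rw [mem_QS] at hp
    rw [Finset.mem_filter, mem_QS]
    refine ⟨⟨hp.1, fun x hx => ?_⟩, ?_⟩
    · simp only [fl]
      rw [if_neg (by omega)]
      exact hp.2 x (by omega)
    · simp only [fl]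
      rw [if_pos le_rfl, hp.2 D le_rfl]
      simp
  · intro p _; exact hfl p
  · intro p _; exact hfl p
  · intro p hp
    rw [Finset.mem_filter, mem_QS] at hp
    have : (Finset.range (d + 1)).val.map (lab lam p) =
        ((Finset.range (d + 1)).val.map (lab lam (fl p))).map negL := by
      rw [Multiset.map_map]
      apply Multiset.map_congr rfl
      intro i hi
      have hi : i < d + 1 := Finset.mem_range.1 hi
      simp only [Function.comp]
      obtain ⟨c1, c2⟩ := chain_mem (fl p) i (by omega)
      unfold lab
      rw [← hanti _ _ c1 c2]
      have hx : ∀ x, (p.1 x : ℕ) ≤ i → (x : ℕ) ≤ d := by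
        intro x hx
        have := (fix_lt hp.1.1 x).1 (by omega)
        omega
      congr 1
      · ext x
        have := hx x
        simp only [posP, negP, fl, Finset.mem_filter]
        grind
      · ext x
        have := hx x
        simp only [posP, negP, fl, Finset.mem_filter]
        grind
    rw [this, FM_neg]
    rfl

/-- octahedral Tucker lemma -/
theorem tucker (N : ℕ) (hN : N < n)
    (hanti : ∀ A B, Disjoint A B → (A ∪ B).Nonempty → lam B A = negL (lam A B))
    (hcomp : ∀ A B A' B', Disjoint A B → (A ∪ B).Nonempty → Disjoint A' B' → A ⊆ A' → B ⊆ B' →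
      lam A' B' ≠ negL (lam A B))
    (hbd : ∀ A B, Disjoint A B → (A ∪ B).Nonempty → (lam A B).1 < N) : False := by
  have h0 : aN lam 0 = 1 := by
    have : QS n 0 0 = {(1, fun _ => true)} := by
      ext p
      rw [mem_QS, Finset.mem_singleton, Prod.ext_iff]
      constructor
      · rintro ⟨h1, h2⟩
        exact ⟨Equiv.ext fun x => h1 x (by omega), funext fun x => h2 x (by omega)⟩
      · rintro ⟨h1, h2⟩
        rw [h1, h2]
        simp
    unfold aN
    rw [this, Finset.sum_singleton]
    unfold FM
    rw [if_pos]
    exact ⟨[], by simp, by simp, rfl⟩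
  have hall : ∀ d, d ≤ n → aN lam d = 1 := by
    intro d
    induction d with
    | zero => intro _; exact h0
    | succ d ih =>
      intro hd
      rw [aN_step lam hanti hcomp d (by omega), ih (by omega)]
  have hz : aN lam n = 0 := by
    unfold aN
    apply Finset.sum_eq_zero
    intro p _
    unfold FM
    rw [if_neg]
    rintro ⟨l, hl, hs, -⟩
    have hlen : l.length = n := by
      have := congrArg Multiset.card hl
      simpa using this
    have hnd : (l.map Prod.fst).Nodup := by
      rw [List.Nodup, List.pairwise_map]
      exact hs.imp (fun h => Nat.ne_of_lt h)
    have hsub : (l.map Prod.fst).toFinset ⊆ Finset.range N := by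
      intro k hk
      rw [List.mem_toFinset, List.mem_map] at hk
      obtain ⟨a, ha, rfl⟩ := hk
      have ha' : a ∈ (l : Multiset (ℕ × Bool)) := ha
      rw [hl] at ha'
      obtain ⟨i, -, rfl⟩ := Multiset.mem_map.1 ha'
      obtain ⟨c1, c2⟩ := chain_mem p i (by omega)
      exact Finset.mem_range.2 (hbd _ _ c1 c2)
    have hc := Finset.card_le_card hsub
    rw [List.toFinset_card_of_nodup hnd, List.length_map, Finset.card_range] at hc
    omega
  rw [hall n le_rfl] at hz
  exact absurd hz (by decide)

end tucker

/-- Kneser type statement for intersecting families -/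
theorem kneser_aux {m n q : ℕ} (hq : 1 ≤ q) (hN : 2 * q - 2 + n < m)
    (G : ℕ → Finset (Fin m) → Prop)
    (hlt : ∀ i A, G i A → i < n)
    (hup : ∀ i A B, A ⊆ B → G i A → G i B)
    (hint : ∀ i A B, Disjoint A B → G i A → G i B → False)
    (hall : ∀ A : Finset (Fin m), q ≤ A.card → ∃ i, G i A) : False := by
  classical
  let ix : Finset (Fin m) → Finset (Fin m) → ℕ := fun A B =>
    Classical.epsilon (fun i => G i A ∨ G i B)
  have ix_symm : ∀ A B, ix B A = ix A B := by
    intro A B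
    simp only [ix]
    congr 1
    funext i
    exact propext or_comm
  let mn : Finset (Fin m) → Finset (Fin m) → Prop := fun A B => ∃ x ∈ A, ∀ y ∈ A ∪ B, x ≤ y
  let lam : Finset (Fin m) → Finset (Fin m) → ℕ × Bool := fun A B =>
    if A.card + B.card ≤ 2 * q - 2 then (A.card + B.card - 1, decide (mn A B))
    else (2 * q - 2 + ix A B, decide (G (ix A B) A))
  have hix : ∀ A B : Finset (Fin m), ¬ (A.card + B.card ≤ 2 * q - 2) →
      G (ix A B) A ∨ G (ix A B) B := by
    intro A B h
    have : ∃ i, G i A ∨ G i B := by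
      by_cases hA : q ≤ A.card
      · obtain ⟨i, hi⟩ := hall A hA; exact ⟨i, Or.inl hi⟩
      · obtain ⟨i, hi⟩ := hall B (by omega); exact ⟨i, Or.inr hi⟩
    exact Classical.epsilon_spec this
  have hcard : ∀ A B : Finset (Fin m), (A ∪ B).Nonempty → 1 ≤ A.card + B.card := by
    intro A B h
    have := Finset.card_pos.2 h
    have := Finset.card_union_le A B
    omega
  have hanti : ∀ A B, Disjoint A B → (A ∪ B).Nonempty → lam B A = negL (lam A B) := by
    intro A B hd hne
    by_cases h : A.card + B.card ≤ 2 * q - 2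
    · have h' : B.card + A.card ≤ 2 * q - 2 := by omega
      simp only [lam, if_pos h, if_pos h', negL, add_comm B.card]
      congr 1
      have : mn B A ↔ ¬ mn A B := by
        constructor
        · rintro ⟨x, hx, hx'⟩ ⟨y, hy, hy'⟩
          have h1 := hx' y (by simp [hy])
          have h2 := hy' x (by simp [hx])
          have := le_antisymm h1 h2
          subst this
          exact Finset.disjoint_left.1 hd hy hx
        · intro hn
          have hmem := Finset.min'_mem _ hne
          rcases Finset.mem_union.1 hmem with h1 | h1
          · exact absurd ⟨_, h1, fun y hy => Finset.min'_le _ _ hy⟩ hn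
          · exact ⟨_, h1, fun y hy => Finset.min'_le _ _ (by rwa [Finset.union_comm])⟩
      simp [this]
    · have h' : ¬ (B.card + A.card ≤ 2 * q - 2) := by omega
      simp only [lam, if_neg h, if_neg h', negL, ix_symm A B]
      congr 1
      have : G (ix A B) B ↔ ¬ G (ix A B) A := by
        constructor
        · intro h1 h2; exact hint _ _ _ hd h2 h1
        · intro h1; exact (hix A B h).resolve_left h1
      simp [this]
  refine tucker lam (2 * q - 2 + n) hN hanti ?_ ?_
  · intro A B A' B' hd hne hd' hA hB heq
    have cA := Finset.card_le_card hA
    have cB := Finset.card_le_card hB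
    have c1 := hcard A B hne
    by_cases h : A.card + B.card ≤ 2 * q - 2
    · by_cases h' : A'.card + B'.card ≤ 2 * q - 2
      · have e := heq
        simp only [lam, if_pos h, if_pos h', negL, Prod.mk.injEq] at e
        have eA := Finset.eq_of_subset_of_card_le hA (by omega)
        have eB := Finset.eq_of_subset_of_card_le hB (by omega)
        subst eA eB
        simp at e
      · simp only [lam, if_pos h, if_neg h', negL, Prod.mk.injEq] at heq
        omega
    · have h' : ¬ (A'.card + B'.card ≤ 2 * q - 2) := by omega
      simp only [lam, if_neg h, if_neg h', negL, Prod.mk.injEq] at heq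
      obtain ⟨e1, e2⟩ := heq
      have e1 : ix A' B' = ix A B := by omega
      rw [e1] at e2
      by_cases hg : G (ix A B) A
      · have := hup _ _ _ hA hg
        simp [hg, this] at e2
      · have h2 := hup _ _ _ hB ((hix A B h).resolve_left hg)
        have h3 : ¬ G (ix A B) A' := fun h3 => hint _ _ _ hd' h3 h2
        simp [hg, h3] at e2
  · intro A B hd hne
    have c1 := hcard A B hne
    by_cases h : A.card + B.card ≤ 2 * q - 2
    · simp only [lam, if_pos h]; omega
    · simp only [lam, if_neg h]
      have : ix A B < n := by
        rcases hix A B h with h1 | h1 <;> exact hlt _ _ h1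
      omega

theorem pref_mono {m : ℕ} (R : Finset (Fin m) → Finset (Fin m) → Prop)
    (h : IsPref R) (hm : MonotonicPref R) (A B : Finset (Fin m)) (hAB : A ⊆ B) : R B A := by
  have key : ∀ C : Finset (Fin m), R (C ∪ A) A := by
    intro C
    induction C using Finset.induction_on with
    | empty => rw [Finset.empty_union]; exact (h.1 A A).elim id id
    | insert x C _ ih =>
      rw [Finset.insert_union]
      exact h.2 _ _ _ (hm _ x) ih
  have := key B
  rwa [Finset.union_eq_left.2 hAB] at this

/-- `n` players with monotonic preferences: there is a subset of size at most
`min(⌈(m+n−1)/2⌉, m) = min((m+n)/2, m)` (ℕ-division) agreeable to all players. -/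
theorem stmt_11 {m n : ℕ}
    (R : Fin n → Finset (Fin m) → Finset (Fin m) → Prop)
    (hpref : ∀ i, IsPref (R i)) (hmono : ∀ i, MonotonicPref (R i)) :
    ∃ T : Finset (Fin m), T.card ≤ min ((m + n) / 2) m ∧ ∀ i, R i T Tᶜ := by
  by_cases hk : m ≤ (m + n) / 2
  · refine ⟨Finset.univ, ?_, fun i => pref_mono _ (hpref i) (hmono i) _ _ (Finset.subset_univ _)⟩
    simp [hk]
  · by_contra hcon
    push Not at hcon
    have hbad : ∀ T : Finset (Fin m), T.card ≤ (m + n) / 2 → ∃ i, ¬ R i T Tᶜ := by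
      intro T hT
      exact hcon T (by rw [le_min_iff]; omega)
    refine kneser_aux (m := m) (n := n) (q := m - (m + n) / 2) (by omega) (by omega)
      (fun i A => ∃ h : i < n, ¬ R ⟨i, h⟩ Aᶜ A) ?_ ?_ ?_ ?_
    · rintro i A ⟨h, -⟩; exact h
    · rintro i A B hAB ⟨h, hA⟩
      refine ⟨h, fun hB => hA ?_⟩
      have h1 := pref_mono _ (hpref ⟨i, h⟩) (hmono ⟨i, h⟩) _ _ hAB
      have h2 := pref_mono _ (hpref ⟨i, h⟩) (hmono ⟨i, h⟩) _ _ (Finset.compl_subset_compl.2 hAB)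
      exact (hpref ⟨i, h⟩).2 _ _ _ h2 ((hpref ⟨i, h⟩).2 _ _ _ hB h1)
    · rintro i A B hd ⟨h, hA⟩ ⟨h', hB⟩
      have hP := hpref ⟨i, h⟩
      have h1 := pref_mono _ hP (hmono ⟨i, h⟩) A Bᶜ
        (Finset.subset_compl_iff_disjoint_right.2 hd)
      have h2 := pref_mono _ hP (hmono ⟨i, h⟩) B Aᶜ
        (Finset.subset_compl_iff_disjoint_right.2 hd.symm)
      rcases hP.1 A B with h3 | h3
      · exact hB (hP.2 _ _ _ h1 h3)
      · exact hA (hP.2 _ _ _ h2 h3)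
    · intro A hA
      obtain ⟨i, hi⟩ := hbad Aᶜ (by rw [Finset.card_compl, Fintype.card_fin]; omega)
      rw [compl_compl] at hi
      exact ⟨i, i.2, hi⟩
end

section
/- Assume that there are three players with responsive preferences ≽_1, ≽_2, ≽_3 on the subsets of a set S of m items. Then there exists a subset T ⊆ S with |T| ≤ ⌈m/2⌉ + 1 such that T is agreeable to all three players, i.e., T ≽_i S∖T for i = 1, 2, 3. -/
open Finset

/-- A preference on subsets is (self-)responsive if it is monotonic and
`(T \ {y}) ∪ {x} ≽ T` whenever `x ∉ T`, `y ∈ T` and `{x} ≽ {y}`. -/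
def SelfResponsive {m : ℕ} (R : Finset (Fin m) → Finset (Fin m) → Prop) : Prop :=
  MonotonicPref R ∧
    ∀ (T : Finset (Fin m)) (x y : Fin m),
      x ∉ T → y ∈ T → R {x} {y} → R (insert x (T.erase y)) T

/-- Two fixed-point-free involutions admit a common proper 2-colouring. -/
theorem aux_color {α : Type*} (σ τ : Equiv.Perm α) (hσ : ∀ x, σ (σ x) = x)
    (hτ : ∀ x, τ (τ x) = x) (nσ : ∀ x, σ x ≠ x) (nτ : ∀ x, τ x ≠ x) :
    ∃ c : α → Bool, (∀ x, c (σ x) = !c x) ∧ (∀ x, c (τ x) = !c x) := by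
  classical
  set ρ : Equiv.Perm α := σ * τ with hρ
  have hσ1 : σ * σ = 1 := Equiv.ext hσ
  have hτ1 : τ * τ = 1 := Equiv.ext hτ
  have hσi : σ⁻¹ = σ := inv_eq_of_mul_eq_one_left hσ1
  have hτi : τ⁻¹ = τ := inv_eq_of_mul_eq_one_left hτ1
  have hconj : σ * ρ * σ⁻¹ = ρ⁻¹ := by
    rw [hρ, mul_inv_rev, hσi, hτi, ← mul_assoc, hσ1, one_mul]
  have hconjn : ∀ n : ℤ, σ * ρ ^ n = ρ ^ (-n) * σ := by
    intro n
    have : σ * ρ ^ n * σ⁻¹ = ρ ^ (-n) := by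
      rw [← conj_zpow, hconj, inv_zpow, zpow_neg]
    rw [← this]; group
  have hστ : σ * ρ = τ := by rw [hρ, ← mul_assoc, hσ1, one_mul]
  have key : ∀ x, ¬ ρ.SameCycle x (σ x) := by
    rintro x ⟨n, hn⟩
    have hx : (σ * ρ ^ n) x = x := by
      rw [Equiv.Perm.mul_apply, hn, hσ]
    rcases Int.even_or_odd' n with ⟨j, rfl | rfl⟩
    · apply nσ ((ρ ^ j) x)
      have h2 : σ * ρ ^ j = ρ ^ j * (σ * ρ ^ (2 * j)) := by
        rw [hconjn, hconjn, ← mul_assoc, ← zpow_add]; congr 2; ring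
      rw [← Equiv.Perm.mul_apply, h2, Equiv.Perm.mul_apply, hx]
    · apply nτ ((ρ ^ j) x)
      have h2 : τ * ρ ^ j = ρ ^ j * (σ * ρ ^ (2 * j + 1)) := by
        rw [← hστ, mul_assoc, ← zpow_one_add, hconjn, hconjn, ← mul_assoc, ← zpow_add]
        congr 2; ring
      rw [← Equiv.Perm.mul_apply, h2, Equiv.Perm.mul_apply, hx]
  let Q := Quotient (Equiv.Perm.SameCycle.setoid ρ)
  let _ : LinearOrder Q := linearOrderOfSTO (WellOrderingRel (α := Q))
  let q : α → Q := fun x => Quotient.mk _ x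
  have hq : ∀ x y, q x = q y ↔ ρ.SameCycle x y := fun x y => Quotient.eq
  have hne : ∀ x, q x ≠ q (σ x) := fun x h => key x ((hq _ _).1 h)
  have hτq : ∀ x, q (τ x) = q (σ x) := by
    intro x
    refine (hq _ _).2 (Equiv.Perm.SameCycle.symm ⟨-1, ?_⟩)
    rw [zpow_neg_one, hρ, mul_inv_rev, hσi, hτi, Equiv.Perm.mul_apply, hσ]
  have hστq : ∀ x, q (σ (τ x)) = q x := by
    intro x
    exact (hq _ _).2 (Equiv.Perm.SameCycle.symm ⟨1, by rw [zpow_one]; rfl⟩)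
  refine ⟨fun x => decide (q x < q (σ x)), fun x => ?_, fun x => ?_⟩
  · simp only [hσ]
    rcases lt_or_gt_of_ne (hne x) with h | h <;> simp [h, h.le]
  · simp only [hτq, hστq]
    rcases lt_or_gt_of_ne (hne x) with h | h <;> simp [h, h.le]

theorem aux_sort {W : Type*} [Fintype W] (k : ℕ) (hk : Fintype.card W = k * 2) (r : W → ℕ) :
    ∃ e : Fin k × Fin 2 ≃ W, ∀ p q, p.1 < q.1 → r (e p) ≤ r (e q) := by
  classical
  let e0 : Fin (k * 2) ≃ W := (Fintype.equivFinOfCardEq hk).symm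
  let s := Tuple.sort (r ∘ e0)
  refine ⟨finProdFinEquiv.trans (s.trans e0), fun p q h => ?_⟩
  have hm := Tuple.monotone_sort (r ∘ e0)
  refine hm (a := finProdFinEquiv p) (b := finProdFinEquiv q) ?_
  rw [Fin.le_def]
  simp only [finProdFinEquiv_apply_val]
  have := p.2.isLt
  have h' : (p.1 : ℕ) < q.1 := h
  omega

theorem aux_color2 {W : Type*} (k : ℕ) (e f : Fin k × Fin 2 ≃ W) :
    ∃ c : W → Bool, (∀ j, c (e (j, 1)) = !c (e (j, 0))) ∧ (∀ j, c (f (j, 1)) = !c (f (j, 0))) := by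
  let sw : Equiv.Perm (Fin k × Fin 2) := Equiv.prodCongr (Equiv.refl _) (Equiv.swap 0 1)
  have hs : ∀ p, sw (sw p) = p := by
    rintro ⟨j, b⟩; simp [sw]
  have hn : ∀ p, sw p ≠ p := by
    rintro ⟨j, b⟩; fin_cases b <;> simp [sw]
  obtain ⟨c, h1, h2⟩ := aux_color ((e.symm.trans sw).trans e) ((f.symm.trans sw).trans f)
    (by intro x; simp [hs]) (by intro x; simp [hs])
    (by intro x h; apply hn (e.symm x); apply e.injective; simpa using h)
    (by intro x h; apply hn (f.symm x); apply f.injective; simpa using h)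
  refine ⟨c, fun j => ?_, fun j => ?_⟩
  · simpa [sw] using h1 (e (j, 0))
  · simpa [sw] using h2 (f (j, 0))

theorem aux_mono {m : ℕ} {R : Finset (Fin m) → Finset (Fin m) → Prop} (h : IsPref R)
    (hr : SelfResponsive R) {A B : Finset (Fin m)} (hAB : B ⊆ A) : R A B := by
  classical
  have key : ∀ D : Finset (Fin m), R (D ∪ B) B := by
    intro D
    induction D using Finset.induction_on with
    | empty => simpa using (h.1 B B).elim id id
    | insert x D _ ih =>
      rw [Finset.insert_union]
      exact h.2 _ _ _ (hr.1 _ x) ih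
  have := key A
  rwa [Finset.union_eq_left.2 hAB] at this

theorem aux_dom {m : ℕ} {R : Finset (Fin m) → Finset (Fin m) → Prop} (h : IsPref R)
    (hr : SelfResponsive R) {A B : Finset (Fin m)} (hd : ∀ x ∈ A, x ∉ B)
    (g : Fin m → Fin m) (hg : ∀ x ∈ B, g x ∈ A) (hinj : ∀ x ∈ B, ∀ y ∈ B, g x = g y → x = y)
    (hR : ∀ x ∈ B, R {g x} {x}) : R A B := by
  classical
  have key : ∀ D : Finset (Fin m), D ⊆ B → R (D.image g ∪ (B \ D)) B := by
    intro D
    induction D using Finset.induction_on with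
    | empty => intro _; simpa using (h.1 B B).elim id id
    | insert x D hx ih =>
      intro hDB
      have hxB : x ∈ B := hDB (Finset.mem_insert_self _ _)
      have hD : D ⊆ B := fun y hy => hDB (Finset.mem_insert_of_mem hy)
      refine h.2 _ _ _ ?_ (ih hD)
      have h1 : g x ∉ D.image g ∪ (B \ D) := by
        simp only [Finset.mem_union, Finset.mem_image, Finset.mem_sdiff, not_or, not_exists, not_and]
        refine ⟨fun y hy hyx => ?_, fun hB => absurd hB (hd _ (hg x hxB))⟩
        exact hx (hinj y (hD hy) x hxB hyx ▸ hy)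
      have h2 : x ∈ D.image g ∪ (B \ D) := by simp [hxB, hx]
      have h3 := hr.2 _ _ _ h1 h2 (hR x hxB)
      convert h3 using 1
      ext y
      simp only [Finset.mem_union, Finset.mem_image, Finset.mem_sdiff, Finset.mem_insert,
        Finset.mem_erase]
      constructor
      · rintro (⟨z, rfl | hz, rfl⟩ | ⟨hy, hn⟩)
        · exact Or.inl rfl
        · refine Or.inr ⟨fun hzx => ?_, Or.inl ⟨z, hz, rfl⟩⟩
          exact hd _ (hg z (hD hz)) (hzx ▸ hxB)
        · exact Or.inr ⟨fun e => hn (Or.inl e), Or.inr ⟨hy, fun e => hn (Or.inr e)⟩⟩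
      · rintro (rfl | ⟨hyx, ⟨z, hz, rfl⟩ | ⟨hy, hn⟩⟩)
        · exact Or.inl ⟨x, Or.inl rfl, rfl⟩
        · exact Or.inl ⟨z, Or.inr hz, rfl⟩
        · exact Or.inr ⟨hy, fun e => e.elim hyx hn⟩
  have := key B (Finset.Subset.refl _)
  rw [Finset.sdiff_self, Finset.union_empty] at this
  refine h.2 _ _ _ (aux_mono h hr ?_) this
  intro y hy
  obtain ⟨x, hx, rfl⟩ := Finset.mem_image.1 hy
  exact hg x hx

theorem aux_rank {m : ℕ} {R : Finset (Fin m) → Finset (Fin m) → Prop} (h : IsPref R) :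
    ∃ r : Fin m → ℕ, ∀ x y, r x ≤ r y → R {x} {y} := by
  classical
  refine ⟨fun x => (univ.filter (fun z => R {z} {x})).card, fun x y hxy => ?_⟩
  by_contra hn
  have hyx : R {y} {x} := (h.1 _ _).resolve_left hn
  refine absurd hxy (not_le.2 (Finset.card_lt_card ?_))
  rw [Finset.ssubset_iff_of_subset]
  · refine ⟨x, ?_, ?_⟩
    · simpa using (h.1 {x} {x}).elim id id
    · simpa using hn
  · intro z hz
    simp only [Finset.mem_filter, Finset.mem_univ, true_and] at hz ⊢
    exact h.2 _ _ _ hz hyx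

/-- the set of items that are common or of colour `t` -/
def auxT {m : ℕ} (C : Finset (Fin m)) (c : {x : Fin m // x ∉ C} → Bool) (t : Bool) :
    Finset (Fin m) := univ.filter (fun x => ∀ h : x ∉ C, c ⟨x, h⟩ = t)

theorem aux_pair_inj {W : Type*} {k : ℕ} (e : Fin k × Fin 2 ≃ W) (c : W → Bool)
    (hc : ∀ j, c (e (j, 1)) = !c (e (j, 0))) (x y : W) (hxy : c x = c y)
    (h : (e.symm x).1 = (e.symm y).1) : x = y := by
  obtain ⟨⟨j, b⟩, rfl⟩ := e.surjective x
  obtain ⟨⟨j', b'⟩, rfl⟩ := e.surjective y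
  simp only [Equiv.symm_apply_apply] at h
  subst h
  have := hc j
  fin_cases b <;> fin_cases b' <;> simp_all

theorem aux_card {m k : ℕ} (C : Finset (Fin m)) (e : Fin k × Fin 2 ≃ {x : Fin m // x ∉ C})
    (c : {x : Fin m // x ∉ C} → Bool)
    (hc : ∀ j, c (e (j, 1)) = !c (e (j, 0))) (t : Bool) : (auxT C c t).card ≤ C.card + k := by
  classical
  have hsub : auxT C c t ⊆ C ∪ (univ.filter (fun w => c w = t)).image Subtype.val := by
    intro x hx
    simp only [auxT, Finset.mem_filter, Finset.mem_univ, true_and] at hx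
    by_cases hC : x ∈ C
    · simp [hC]
    · simp [hC, hx hC]
  refine (Finset.card_le_card hsub).trans ((Finset.card_union_le _ _).trans ?_)
  refine Nat.add_le_add_left (Finset.card_image_le.trans ?_) _
  have : (univ.filter (fun w => c w = t)).card ≤ (univ : Finset (Fin k)).card := by
    refine Finset.card_le_card_of_injOn (fun w => (e.symm w).1) (by simp) ?_
    intro x hx y hy hxy
    refine aux_pair_inj e c hc x y ?_ hxy
    simp at hx hy
    rw [hx, hy]
  simpa using this

theorem aux_agree {m k : ℕ} {R : Finset (Fin m) → Finset (Fin m) → Prop} (h : IsPref R)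
    (hr : SelfResponsive R) (r : Fin m → ℕ) (hrk : ∀ x y, r x ≤ r y → R {x} {y})
    (C : Finset (Fin m)) (a : Fin m) (ha : a ∈ C) (hmin : ∀ x, r a ≤ r x)
    (e : Fin k × Fin 2 ≃ {x : Fin m // x ∉ C})
    (he : ∀ p q, p.1 < q.1 → r (e p) ≤ r (e q))
    (c : {x : Fin m // x ∉ C} → Bool)
    (hc : ∀ j, c (e (j, 1)) = !c (e (j, 0))) (t : Bool) :
    R (auxT C c t) (auxT C c t)ᶜ := by
  classical
  have hB : ∀ x, x ∈ (auxT C c t)ᶜ → ∃ h : x ∉ C, c ⟨x, h⟩ = !t := by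
    intro x hx
    simp only [auxT, Finset.mem_compl, Finset.mem_filter, Finset.mem_univ, true_and,
      not_forall] at hx
    obtain ⟨h1, h2⟩ := hx
    exact ⟨h1, by cases t <;> simpa using h2⟩
  -- the member of colour t in each pair
  have hsel : ∀ j, ∃ b, c (e (j, b)) = t := by
    intro j
    by_cases h0 : c (e (j, 0)) = t
    · exact ⟨0, h0⟩
    · refine ⟨1, ?_⟩
      rw [hc]
      cases t <;> simpa using h0
  choose b hb using hsel
  let gp : Fin k → Fin m := fun j =>
    if h0 : (j : ℕ) = 0 then a
    else (e (⟨j - 1, by omega⟩, b ⟨j - 1, by omega⟩)).1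
  have gp_inj : ∀ i j, gp i = gp j → i = j := by
    intro i j hij
    simp only [gp] at hij
    split_ifs at hij with h1 h2 h2
    · exact Fin.ext (by omega)
    · exact absurd (hij ▸ ha) (e _).2
    · exact absurd (hij ▸ ha) (e _).2
    · have := congrArg Prod.fst (e.injective (Subtype.ext hij))
      simp only [Fin.mk.injEq] at this
      exact Fin.ext (by omega)
  have gp_mem : ∀ j, gp j ∈ auxT C c t := by
    intro j
    simp only [auxT, Finset.mem_filter, Finset.mem_univ, true_and, gp]
    split_ifs with h1
    · intro h; exact absurd ha h
    · intro _; exact hb _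
  have gp_le : ∀ p : Fin k × Fin 2, r (gp p.1) ≤ r (e p) := by
    intro p
    simp only [gp]
    split_ifs with h1
    · exact hmin _
    · apply he
      rw [Fin.lt_def]
      simp only
      omega
  refine aux_dom h hr (fun x hx => by simpa using hx)
    (fun x => if hx : x ∉ C then gp (e.symm ⟨x, hx⟩).1 else a) ?_ ?_ ?_
  · intro x hx
    obtain ⟨h1, -⟩ := hB x hx
    simp only [h1, not_false_eq_true, dif_pos]
    exact gp_mem _
  · intro x hx y hy hxy
    obtain ⟨h1, h1'⟩ := hB x hx
    obtain ⟨h2, h2'⟩ := hB y hy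
    simp only [h1, h2, not_false_eq_true, dif_pos] at hxy
    have := aux_pair_inj e c hc ⟨x, h1⟩ ⟨y, h2⟩ (h1'.trans h2'.symm) (gp_inj _ _ hxy)
    exact congrArg Subtype.val this
  · intro x hx
    obtain ⟨h1, -⟩ := hB x hx
    simp only [h1, not_false_eq_true, dif_pos]
    apply hrk
    have := gp_le (e.symm ⟨x, h1⟩)
    simpa using this

/-- Three players with responsive preferences: there is a subset of size at most
`⌈m/2⌉ + 1 = (m+1)/2 + 1` (ℕ-division) agreeable to all three. -/
theorem stmt_13 {m : ℕ}
    (R1 R2 R3 : Finset (Fin m) → Finset (Fin m) → Prop)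
    (h1 : IsPref R1) (h2 : IsPref R2) (h3 : IsPref R3)
    (hr1 : SelfResponsive R1) (hr2 : SelfResponsive R2) (hr3 : SelfResponsive R3) :
    ∃ T : Finset (Fin m), T.card ≤ (m + 1) / 2 + 1 ∧
      R1 T Tᶜ ∧ R2 T Tᶜ ∧ R3 T Tᶜ := by
  classical
  by_cases hm : m ≤ 2
  · refine ⟨univ, by simp; omega, ?_, ?_, ?_⟩
    · exact aux_mono h1 hr1 (by simp)
    · exact aux_mono h2 hr2 (by simp)
    · exact aux_mono h3 hr3 (by simp)
  obtain ⟨r1, k1⟩ := aux_rank h1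
  obtain ⟨r2, k2⟩ := aux_rank h2
  have : Nonempty (Fin m) := ⟨⟨0, by omega⟩⟩
  obtain ⟨a, ha⟩ := Finite.exists_min r1
  obtain ⟨b, hb⟩ := Finite.exists_min r2
  obtain ⟨n, k, hn2, hn, hk⟩ : ∃ n k : ℕ, 2 ≤ n ∧ n + k * 2 = m ∧ n + k ≤ (m + 1) / 2 + 1 := by
    rcases Nat.even_or_odd' m with ⟨j, hj | hj⟩
    · exact ⟨2, j - 1, by omega, by omega, by omega⟩
    · exact ⟨3, j - 1, by omega, by omega, by omega⟩
  obtain ⟨C, hC, hCn⟩ : ∃ C : Finset (Fin m), {a, b} ⊆ C ∧ C.card = n := by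
    apply Finset.exists_superset_card_eq
    · exact Finset.card_le_two.trans hn2
    · simp; omega
  have hcard : Fintype.card {x : Fin m // x ∉ C} = k * 2 := by
    rw [Fintype.card_subtype_compl]; simp; omega
  obtain ⟨e, he⟩ := aux_sort k hcard (fun x => r1 x.1)
  obtain ⟨f, hf⟩ := aux_sort k hcard (fun x => r2 x.1)
  obtain ⟨c, hce, hcf⟩ := aux_color2 k e f
  have A1 := aux_agree h1 hr1 r1 k1 C a (hC (by simp)) ha e he c hce
  have A2 := aux_agree h2 hr2 r2 k2 C b (hC (by simp)) hb f hf c hcf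
  have hsz : ∀ t, (auxT C c t).card ≤ (m + 1) / 2 + 1 := fun t =>
    (aux_card C e c hce t).trans (by omega)
  rcases h3.1 (auxT C c true) (auxT C c true)ᶜ with h | h
  · exact ⟨_, hsz true, A1 true, A2 true, h⟩
  · refine ⟨_, hsz false, A1 false, A2 false, ?_⟩
    have s1 : (auxT C c true)ᶜ ⊆ auxT C c false := by
      intro x hx
      simp only [auxT, Finset.mem_compl, Finset.mem_filter, Finset.mem_univ, true_and,
        not_forall] at hx ⊢
      obtain ⟨h1, h2⟩ := hx
      intro _
      simpa using h2
    have s2 : (auxT C c false)ᶜ ⊆ auxT C c true := by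
      exact compl_le_iff_compl_le.1 s1
    exact h3.2 _ _ _ (aux_mono h3 hr3 s1) (h3.2 _ _ _ h (aux_mono h3 hr3 s2))
end

section
/- If there are n players each with a nonnegative monotonic subadditive utility function on the subsets of a set S of m items, then there exists a subset T ⊆ S with |T| ≤ min(⌈(m+n−1)/2⌉, m) such that f_i(T) ≥ (1/2)·f_i(S) for every player i. -/
namespace Fan

/-- Alternation indicator of a list of labels (`l / 2` is the absolute value, parity the sign). -/
def aL : Bool → List ℕ → ZMod 2
  | _, [] => 1
  | ε, (l :: t) => if decide (l % 2 = 0) = ε then aL (!ε) t else 0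

/-- Alternation indicator of a multiset of labels. -/
def al (ε : Bool) (M : Multiset ℕ) : ZMod 2 := aL ε (M.sort (· ≤ ·))

/-- Coboundary. -/
def del (g : Multiset ℕ → ZMod 2) (M : Multiset ℕ) : ZMod 2 :=
  (M.map (fun a => g (M.erase a))).sum

theorem al_zero (ε : Bool) : al ε 0 = 1 := by simp [al, aL]

theorem al_cons (ε : Bool) (s : ℕ) (M : Multiset ℕ) (h : ∀ b ∈ M, s ≤ b) :
    al ε (s ::ₘ M) = if decide (s % 2 = 0) = ε then al (!ε) M else 0 := by
  unfold al
  rw [Multiset.sort_cons (r := (· ≤ ·)) s M h]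
  rfl

theorem min_induction {p : Multiset ℕ → Prop} (h0 : p 0)
    (h1 : ∀ s M, (∀ b ∈ M, s ≤ b) → p M → p (s ::ₘ M)) (M : Multiset ℕ) : p M := by
  have key : ∀ l : List ℕ, l.Pairwise (· ≤ ·) → p (l : Multiset ℕ) := by
    intro l
    induction l with
    | nil => intro _; exact h0
    | cons a t ih =>
      intro h
      rw [List.pairwise_cons] at h
      exact h1 a t (by simpa using h.1) (ih h.2)
  have := key (M.sort (· ≤ ·)) (Multiset.pairwise_sort M _)
  rwa [Multiset.sort_eq] at this

theorem del_cons (g : Multiset ℕ → ZMod 2) (a : ℕ) (M : Multiset ℕ) :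
    del g (a ::ₘ M) = g M + del (fun N => g (a ::ₘ N)) M := by
  unfold del
  rw [Multiset.map_cons, Multiset.sum_cons, Multiset.erase_cons_head]
  congr 2
  apply Multiset.map_congr rfl
  intro b hb
  by_cases h : b = a
  · subst h
    simp only [Multiset.erase_cons_head, Multiset.cons_erase hb]
  · rw [Multiset.erase_cons_tail _ (fun h' => h h'.symm)]

theorem del_al (M : Multiset ℕ) : ∀ ε, del (al ε) M = al true M + al false M := by
  apply min_induction (p := (fun M => ∀ ε, del (al ε) M = al true M + al false M)) ?_ ?_ M
  · intro ε
    simp only [al_zero, del, Multiset.map_zero, Multiset.sum_zero]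
    decide
  · intro s M hs ih ε
    have e1 : del (fun N => al ε (s ::ₘ N)) M =
        if decide (s % 2 = 0) = ε then del (al (!ε)) M else 0 := by
      have : del (fun N => al ε (s ::ₘ N)) M =
          del (fun N => if decide (s % 2 = 0) = ε then al (!ε) N else 0) M := by
        unfold del
        congr 1
        apply Multiset.map_congr rfl
        intro b _
        exact al_cons ε s _ (fun c hc => hs c (Multiset.mem_of_mem_erase hc))
      rw [this]
      split_ifs
      · rfl
      · simp [del]
    rw [del_cons, e1, ih, al_cons _ _ _ hs, al_cons _ _ _ hs]
    cases ε <;> by_cases h : s % 2 = 0 <;> simp [h] <;> generalize al false M = v <;>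
      generalize al true M = u <;> revert u v <;> decide

/-- Negation of labels. -/
def neg (l : ℕ) : ℕ := if l % 2 = 0 then l + 1 else l - 1

/-- No complementary pair. -/
def Good (M : Multiset ℕ) : Prop := ∀ a ∈ M, ∀ b ∈ M, a / 2 = b / 2 → a = b

theorem al_neg (M : Multiset ℕ) : Good M → ∀ ε, al ε (M.map neg) = al (!ε) M := by
  apply min_induction (p := (fun M => Good M → ∀ ε, al ε (M.map neg) = al (!ε) M)) ?_ ?_ M
  · intro _ ε
    simp [al_zero]
  · intro s M hs ih hg ε
    have hg' : Good M := fun a ha b hb =>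
      hg a (Multiset.mem_cons_of_mem ha) b (Multiset.mem_cons_of_mem hb)
    rw [Multiset.map_cons, al_cons, al_cons _ _ _ hs, ih hg']
    · have : decide (neg s % 2 = 0) = !decide (s % 2 = 0) := by
        rw [← decide_not]
        congr 1
        unfold neg
        apply propext
        split_ifs <;> omega
      rw [this]
      cases ε <;> cases decide (s % 2 = 0) <;> simp
    · intro b hb
      obtain ⟨c, hc, rfl⟩ := Multiset.mem_map.1 hb
      have h1 := hs c hc
      have h2 := hg s (Multiset.mem_cons_self _ _) c (Multiset.mem_cons_of_mem hc)
      unfold neg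
      split_ifs <;> omega

theorem al_nodup (M : Multiset ℕ) : Good M → ∀ ε, al ε M ≠ 0 → (M.map (· / 2)).Nodup ∧
    (∀ s ∈ M, (∀ b ∈ M, s ≤ b) → decide (s % 2 = 0) = ε) := by
  apply min_induction (p := (fun M => Good M → ∀ ε, al ε M ≠ 0 → (M.map (· / 2)).Nodup ∧
    (∀ s ∈ M, (∀ b ∈ M, s ≤ b) → decide (s % 2 = 0) = ε))) ?_ ?_ M
  · intro _ ε _
    simp
  · intro s M hs ih hg ε h
    have hg' : Good M := fun a ha b hb =>
      hg a (Multiset.mem_cons_of_mem ha) b (Multiset.mem_cons_of_mem hb)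
    rw [al_cons _ _ _ hs] at h
    have h1 : decide (s % 2 = 0) = ε := by
      by_contra hh
      simp [hh] at h
    rw [if_pos h1] at h
    obtain ⟨i1, i2⟩ := ih hg' _ h
    refine ⟨?_, ?_⟩
    · rw [Multiset.map_cons, Multiset.nodup_cons]
      refine ⟨?_, i1⟩
      intro hm
      obtain ⟨c, hc, hcs⟩ := Multiset.mem_map.1 hm
      have e := hg c (Multiset.mem_cons_of_mem hc) s (Multiset.mem_cons_self _ _) hcs
      subst e
      have := i2 c hc hs
      rw [h1] at this
      cases ε <;> simp at this
    · intro t ht hmin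
      have h2 := hmin s (Multiset.mem_cons_self _ _)
      have : t = s := by
        rcases Multiset.mem_cons.1 ht with h | h
        · exact h
        · exact le_antisymm h2 (hs t h)
      rw [this, h1]

section
variable {m : ℕ} (lam : (Fin m → SignType) → ℕ)

/-- Support. -/
def supp (x : Fin m → SignType) : Finset (Fin m) := Finset.univ.filter (fun i => x i ≠ 0)

/-- Sum of `g` over the full flags below `x`. -/
def I : ℕ → (Fin m → SignType) → (Multiset ℕ → ZMod 2) → ZMod 2
  | 0, _, g => g 0
  | k + 1, x, g => ∑ c ∈ supp x, I k (Function.update x c 0) (fun M => g (lam x ::ₘ M))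

theorem I_add (k : ℕ) : ∀ (x : Fin m → SignType) (g h : Multiset ℕ → ZMod 2),
    I lam k x (fun M => g M + h M) = I lam k x g + I lam k x h := by
  induction k with
  | zero => intro x g h; rfl
  | succ k ih =>
    intro x g h
    simp only [I]
    rw [← Finset.sum_add_distrib]
    exact Finset.sum_congr rfl fun c _ => ih _ _ _

theorem supp_update (x : Fin m → SignType) (c : Fin m) :
    supp (Function.update x c 0) = (supp x).erase c := by
  ext i
  by_cases h : i = c
  · subst h; simp [supp]
  · simp [supp, h]

theorem sym_sum (s : Finset (Fin m)) (F : Fin m → Fin m → ZMod 2) (hF : ∀ a b, F a b = F b a) :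
    ∑ c ∈ s, ∑ d ∈ s.erase c, F c d = 0 := by
  rw [Finset.sum_sigma']
  refine Finset.sum_involution (fun p _ => ⟨p.2, p.1⟩) ?_ ?_ ?_ ?_
  · intro p _
    simp only
    rw [hF p.2 p.1]
    exact CharTwo.add_self_eq_zero _
  · rintro ⟨a, b⟩ hp _ h
    simp at hp h
    exact hp.2.1 h.1
  · rintro ⟨a, b⟩ hp
    simp at hp ⊢
    exact ⟨hp.2.2, fun h => hp.2.1 h.symm, hp.1⟩
  · rintro ⟨a, b⟩ _
    rfl

theorem stokes (k : ℕ) : ∀ (x : Fin m → SignType) (g : Multiset ℕ → ZMod 2),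
    I lam (k + 1) x (del g) = ∑ c ∈ supp x, I lam k (Function.update x c 0) g := by
  induction k with
  | zero =>
    intro x g
    simp [I, del]
  | succ k ih =>
    intro x g
    rw [I]
    simp only [del_cons]
    simp only [I_add]
    rw [Finset.sum_add_distrib]
    simp only [ih, supp_update]
    rw [sym_sum, add_zero]
    intro a b
    by_cases h : a = b
    · rw [h]
    · rw [Function.update_comm h]

theorem I_congr (hgood : ∀ x y : Fin m → SignType, y ≠ 0 → (∀ i, y i ≠ 0 → y i = x i) →
      lam y / 2 = lam x / 2 → lam y = lam x) (k : ℕ) :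
    ∀ (x : Fin m → SignType) (g h : Multiset ℕ → ZMod 2),
    (∀ M, M.card = k → (∀ a ∈ M, ∃ y, y ≠ 0 ∧ (∀ i, y i ≠ 0 → y i = x i) ∧ lam y = a) →
      Good M → g M = h M) → I lam k x g = I lam k x h := by
  induction k with
  | zero =>
    intro x g h H
    exact H 0 rfl (by simp) (by simp [Good])
  | succ k ih =>
    intro x g h H
    simp only [I]
    refine Finset.sum_congr rfl fun c hc => ih _ _ _ ?_
    intro M hM hy hg
    have hx : x ≠ 0 := by
      rintro rfl
      simp [supp] at hc
    have hy' : ∀ a ∈ M, ∃ y, y ≠ 0 ∧ (∀ i, y i ≠ 0 → y i = x i) ∧ lam y = a := by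
      intro a ha
      obtain ⟨y, h0, h1, h2⟩ := hy a ha
      refine ⟨y, h0, ?_, h2⟩
      intro i hi
      have := h1 i hi
      by_cases hic : i = c
      · subst hic
        simp at this
        exact absurd this hi
      · simpa [hic] using this
    apply H
    · simp [hM]
    · intro a ha
      rcases Multiset.mem_cons.1 ha with rfl | ha
      · exact ⟨x, hx, fun _ _ => rfl, rfl⟩
      · exact hy' a ha
    · intro a ha b hb hab
      rcases Multiset.mem_cons.1 ha with ha | ha <;> rcases Multiset.mem_cons.1 hb with hb | hb
      · rw [ha, hb]
      · obtain ⟨y, h0, h1, h2⟩ := hy' b hb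
        subst ha h2
        exact (hgood x y h0 h1 hab.symm).symm
      · obtain ⟨y, h0, h1, h2⟩ := hy' a ha
        subst hb h2
        exact hgood x y h0 h1 hab
      · exact hg a ha b hb hab

theorem I_neg (hneg : ∀ x : Fin m → SignType, x ≠ 0 → lam (-x) = neg (lam x)) (k : ℕ) :
    ∀ (x : Fin m → SignType) (g : Multiset ℕ → ZMod 2),
    I lam k (-x) g = I lam k x (fun M => g (M.map neg)) := by
  induction k with
  | zero => intro x g; simp [I]
  | succ k ih =>
    intro x g
    have hs : supp (-x) = supp x := by
      ext i; simp [supp]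
    simp only [I, hs]
    refine Finset.sum_congr rfl fun c hc => ?_
    have hx : x ≠ 0 := by
      rintro rfl
      simp [supp] at hc
    have hu : Function.update (-x) c 0 = -(Function.update x c 0) := by
      ext i
      by_cases h : i = c
      · subst h; simp
      · simp [h]
    rw [hu, ih, hneg x hx]
    simp only [Multiset.map_cons]

/-- Vectors with support the first `j` coordinates. -/
def full (m j : ℕ) : Finset (Fin m → SignType) :=
  Finset.univ.filter (fun x => ∀ i, x i ≠ 0 ↔ i.1 < j)

theorem mem_full {j : ℕ} {x : Fin m → SignType} : x ∈ full m j ↔ ∀ i, x i ≠ 0 ↔ i.1 < j := by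
  simp [full]

theorem neg_ne_self {s : SignType} (h : s ≠ 0) : -s ≠ s := by
  revert s; decide

theorem fan_step (hgood : ∀ x y : Fin m → SignType, y ≠ 0 → (∀ i, y i ≠ 0 → y i = x i) →
      lam y / 2 = lam x / 2 → lam y = lam x)
    (hneg : ∀ x : Fin m → SignType, x ≠ 0 → lam (-x) = neg (lam x)) (j : ℕ) (hj : j < m) :
    ∑ x ∈ full m (j + 1), I lam (j + 1) x (al true) = ∑ x ∈ full m j, I lam j x (al true) := by
  set c0 : Fin m := ⟨j, hj⟩ with hc0
  set H := (full m (j + 1)).filter (fun x => x c0 = 1) with hH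
  have hsupp : ∀ x ∈ H, supp x = Finset.univ.filter (fun i : Fin m => i.1 < j + 1) := by
    intro x hx
    rw [hH, Finset.mem_filter, mem_full] at hx
    ext i
    simp only [supp, Finset.mem_filter, Finset.mem_univ, true_and]
    exact hx.1 i
  have hA : ∑ x ∈ H, I lam (j + 1) x (del (al true)) =
      ∑ x ∈ full m j, I lam j x (al true) := by
    simp only [stokes]
    rw [Finset.sum_congr rfl (fun x hx => by rw [hsupp x hx])]
    rw [Finset.sum_comm, Finset.sum_eq_single c0]
    · refine Finset.sum_bij' (fun x _ => Function.update x c0 0)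
        (fun x _ => Function.update x c0 1) ?_ ?_ ?_ ?_ ?_
      · intro x hx
        rw [hH, Finset.mem_filter, mem_full] at hx
        rw [mem_full]
        intro i
        by_cases h : i = c0
        · subst h; simp [hc0]
        · have h' : i.1 ≠ j := fun e => h (Fin.ext e)
          rw [Function.update_of_ne h, hx.1 i]
          omega
      · intro x hx
        rw [mem_full] at hx
        rw [hH, Finset.mem_filter, mem_full]
        refine ⟨?_, by simp⟩
        intro i
        by_cases h : i = c0
        · subst h; simp [hc0]
        · have h' : i.1 ≠ j := fun e => h (Fin.ext e)
          rw [Function.update_of_ne h, hx i]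
          omega
      · intro x hx
        rw [hH, Finset.mem_filter, mem_full] at hx
        simp only [Function.update_idem]
        rw [← hx.2, Function.update_eq_self]
      · intro x hx
        rw [mem_full] at hx
        simp only [Function.update_idem]
        have : x c0 = 0 := by
          by_contra h
          have := (hx c0).1 h
          simp [hc0] at this
        rw [← this, Function.update_eq_self]
      · intro x hx
        rfl
    · intro c hc hne
      have hcj : c.1 < j + 1 := by simpa using hc
      refine Finset.sum_involution (fun x _ => Function.update x c (-(x c))) ?_ ?_ ?_ ?_
      · intro x _
        simp only [Function.update_idem]
        exact CharTwo.add_self_eq_zero _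
      · intro x hx _ h
        rw [hH, Finset.mem_filter, mem_full] at hx
        have := congrFun h c
        simp only [Function.update_self] at this
        exact neg_ne_self ((hx.1 c).2 hcj) this
      · intro x hx
        rw [hH, Finset.mem_filter, mem_full] at hx ⊢
        refine ⟨?_, by rw [Function.update_of_ne (Ne.symm hne)]; exact hx.2⟩
        intro i
        by_cases h : i = c
        · subst h
          rw [Function.update_self, ← hx.1 i]
          simp
        · rw [Function.update_of_ne h, hx.1 i]
      · intro x _
        simp
    · intro h
      simp [hc0] at h
  have hB : ∑ x ∈ H, I lam (j + 1) x (del (al true)) =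
      ∑ x ∈ full m (j + 1), I lam (j + 1) x (al true) := by
    have e : del (al true) = fun M => al true M + al false M := by
      funext M; exact del_al M true
    simp only [e, I_add]
    rw [Finset.sum_add_distrib,
      ← Finset.sum_filter_add_sum_filter_not (full m (j + 1)) (fun x => x c0 = 1)]
    congr 1
    refine Finset.sum_bij' (fun x _ => -x) (fun x _ => -x) ?_ ?_ ?_ ?_ ?_
    · intro x hx
      rw [hH, Finset.mem_filter, mem_full] at hx
      rw [Finset.mem_filter, mem_full]
      refine ⟨fun i => by simpa using hx.1 i, ?_⟩
      rw [Pi.neg_apply, hx.2]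
      decide
    · intro x hx
      rw [Finset.mem_filter, mem_full] at hx
      rw [hH, Finset.mem_filter, mem_full]
      refine ⟨fun i => by simpa using hx.1 i, ?_⟩
      have h1 := hx.2
      have h2 := (hx.1 c0).2 (by simp [hc0])
      rw [Pi.neg_apply]
      generalize x c0 = s at h1 h2
      revert s; decide
    · intro x _; simp
    · intro x _; simp
    · intro x _
      rw [I_neg lam hneg]
      apply I_congr lam hgood
      intro M _ _ hg
      rw [al_neg M hg]
      rfl
  rw [← hB, hA]

theorem tucker (hgood : ∀ x y : Fin m → SignType, y ≠ 0 → (∀ i, y i ≠ 0 → y i = x i) →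
      lam y / 2 = lam x / 2 → lam y = lam x)
    (hneg : ∀ x : Fin m → SignType, x ≠ 0 → lam (-x) = neg (lam x))
    (N : ℕ) (hN : ∀ x : Fin m → SignType, x ≠ 0 → lam x / 2 < N) : m ≤ N := by
  have h1 : ∀ j, j ≤ m → ∑ x ∈ full m j, I lam j x (al true) = 1 := by
    intro j
    induction j with
    | zero =>
      intro _
      have : full m 0 = {0} := by
        ext x
        rw [mem_full, Finset.mem_singleton]
        constructor
        · intro h
          ext i
          have := h i
          simpa using this
        · rintro rfl
          simp
      rw [this, Finset.sum_singleton, I, al_zero]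
    | succ j ih =>
      intro hj
      rw [fan_step lam hgood hneg j hj, ih (by omega)]
  by_contra hlt
  have h2 := h1 m le_rfl
  have h3 : ∑ x ∈ full m m, I lam m x (al true) = ∑ x ∈ full m m, I lam m x (fun _ => 0) := by
    refine Finset.sum_congr rfl fun x _ => ?_
    apply I_congr lam hgood
    intro M hM hy hg
    by_contra hne
    have hnd := (al_nodup M hg true hne).1
    have hsub : (⟨M.map (· / 2), hnd⟩ : Finset ℕ) ⊆ Finset.range N := by
      intro a ha
      obtain ⟨b, hb, rfl⟩ := Multiset.mem_map.1 (Finset.mem_mk.1 ha)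
      obtain ⟨y, h0, _, rfl⟩ := hy b hb
      exact Finset.mem_range.2 (hN y h0)
    have := Finset.card_le_card hsub
    simp [hM] at this
    omega
  have h4 : ∀ k (x : Fin m → SignType), I lam k x (fun _ => 0) = 0 := by
    intro k
    induction k with
    | zero => intro x; rfl
    | succ k ih => intro x; simp [I, ih]
  rw [h3] at h2
  simp [h4] at h2

end

/-- Positive part. -/
def pos {m : ℕ} (x : Fin m → SignType) : Finset (Fin m) := Finset.univ.filter (fun i => x i = 1)

theorem pos_disj {m : ℕ} (x y : Fin m → SignType) (h : ∀ i, y i ≠ 0 → y i = x i) :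
    Disjoint (pos y) (pos (-x)) := by
  rw [Finset.disjoint_left]
  intro i h1 h2
  simp only [pos, Finset.mem_filter, Finset.mem_univ, true_and, Pi.neg_apply] at h1 h2
  have := h i (by rw [h1]; decide)
  rw [← this, h1] at h2
  revert h2; decide

theorem supp_card {m : ℕ} (x : Fin m → SignType) :
    (supp x).card = (pos x).card + (pos (-x)).card := by
  rw [← Finset.card_union_of_disjoint (pos_disj x x (fun _ _ => rfl))]
  congr 1
  ext i
  simp only [supp, pos, Finset.mem_union, Finset.mem_filter, Finset.mem_univ, true_and,
    Pi.neg_apply]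
  generalize x i = s
  revert s; decide

theorem kneser {m n r : ℕ} (hr : 1 ≤ r) (P : ℕ → Finset (Fin m) → Prop)
    (hP : ∀ A, r ≤ A.card → ∃ i, i < n ∧ P i A)
    (hPn : ∀ i A, P i A → i < n)
    (hd : ∀ i A B, Disjoint A B → P i A → ¬ P i B) : m ≤ 2 * r - 2 + n := by
  classical
  rcases Nat.eq_zero_or_pos m with hm | hm
  · omega
  have he : ∃ e : Finset (Fin m) → Fin m, ∀ S, S.Nonempty → e S ∈ S := by
    refine ⟨fun S => if h : S.Nonempty then h.choose else ⟨0, hm⟩, ?_⟩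
    intro S h
    simp only [h, dif_pos]
    exact h.choose_spec
  obtain ⟨e, he⟩ := he
  let Q : (Fin m → SignType) → ℕ := fun x => sInf {i | P i (pos x) ∨ P i (pos (-x))}
  have hQ : ∀ x, 2 * r - 2 < (supp x).card → P (Q x) (pos x) ∨ P (Q x) (pos (-x)) := by
    intro x hx
    apply Nat.sInf_mem (s := {i | P i (pos x) ∨ P i (pos (-x))})
    rw [supp_card] at hx
    by_cases h : r ≤ (pos x).card
    · obtain ⟨i, _, hi⟩ := hP _ h
      exact ⟨i, Or.inl hi⟩
    · obtain ⟨i, _, hi⟩ := hP (pos (-x)) (by omega)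
      exact ⟨i, Or.inr hi⟩
  have hQn : ∀ x, Q (-x) = Q x := by
    intro x
    simp only [Q, neg_neg]
    congr 1
    ext i
    exact or_comm
  have hsn : ∀ x : Fin m → SignType, supp (-x) = supp x := by
    intro x; ext i; simp [supp]
  have hs0 : ∀ x : Fin m → SignType, x ≠ 0 → (supp x).Nonempty := by
    intro x hx
    obtain ⟨i, hi⟩ := Function.ne_iff.1 hx
    exact ⟨i, by simpa [supp] using hi⟩
  let lam : (Fin m → SignType) → ℕ := fun x =>
    if (supp x).card ≤ 2 * r - 2 then
      2 * ((supp x).card - 1) + (if x (e (supp x)) = 1 then 0 else 1)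
    else 2 * (2 * r - 2 + Q x) + (if P (Q x) (pos x) then 0 else 1)
  have hl1 : ∀ x, (supp x).card ≤ 2 * r - 2 →
      lam x = 2 * ((supp x).card - 1) + (if x (e (supp x)) = 1 then 0 else 1) := by
    intro x h; simp only [lam, if_pos h]
  have hl2 : ∀ x, ¬ (supp x).card ≤ 2 * r - 2 →
      lam x = 2 * (2 * r - 2 + Q x) + (if P (Q x) (pos x) then 0 else 1) := by
    intro x h; simp only [lam, if_neg h]
  have hd1 : ∀ x, (supp x).card ≤ 2 * r - 2 → lam x / 2 = (supp x).card - 1 := by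
    intro x h; rw [hl1 x h]; split_ifs <;> omega
  have hd2 : ∀ x, ¬ (supp x).card ≤ 2 * r - 2 → lam x / 2 = 2 * r - 2 + Q x := by
    intro x h; rw [hl2 x h]; split_ifs <;> omega
  refine tucker lam ?_ ?_ _ ?_
  · intro x y hy hyx hlam
    have hsub : supp y ⊆ supp x := by
      intro i hi
      simp only [supp, Finset.mem_filter, Finset.mem_univ, true_and] at hi ⊢
      rw [← hyx i hi]; exact hi
    have hc := Finset.card_le_card hsub
    have hy1 := (hs0 y hy).card_pos
    by_cases h1 : (supp y).card ≤ 2 * r - 2 <;> by_cases h2 : (supp x).card ≤ 2 * r - 2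
    · rw [hd1 y h1, hd1 x h2] at hlam
      have hss := Finset.eq_of_subset_of_card_le hsub (by omega)
      have : y = x := by
        ext i
        by_cases hi : y i = 0
        · have : i ∉ supp x := by rw [← hss]; simp [supp, hi]
          have : x i = 0 := by simpa [supp] using this
          rw [hi, this]
        · rw [hyx i hi]
      rw [this]
    · rw [hd1 y h1, hd2 x h2] at hlam
      omega
    · omega
    · rw [hd2 y h1, hd2 x h2] at hlam
      have hq : Q y = Q x := by omega
      have p1 := hQ y (by omega)
      have p2 := hQ x (by omega)
      rw [hl2 y h1, hl2 x h2, hq]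
      rw [hq] at p1
      have d1 := pos_disj x y hyx
      have d2 := pos_disj (-x) (-y) (by
        intro i hi
        simp only [Pi.neg_apply] at hi ⊢
        rw [hyx i (by simpa using hi)])
      rw [neg_neg] at d2
      have f1 := hd (Q x) _ _ d1
      have f2 := hd (Q x) _ _ d2
      have : P (Q x) (pos y) ↔ P (Q x) (pos x) := by tauto
      simp only [this]
  · intro x hx
    by_cases h : (supp x).card ≤ 2 * r - 2
    · rw [hl1 x h, hl1 (-x) (by rw [hsn]; exact h), hsn]
      have hm := he _ (hs0 x hx)
      simp only [supp, Finset.mem_filter, Finset.mem_univ, true_and] at hm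
      have : (-x) (e (supp x)) = 1 ↔ ¬ x (e (supp x)) = 1 := by
        rw [Pi.neg_apply]
        change x (e (supp x)) ≠ 0 at hm
        generalize x (e (supp x)) = s at hm
        revert s; decide
      simp only [this, neg]
      split_ifs <;> omega
    · rw [hl2 x h, hl2 (-x) (by rw [hsn]; exact h), hQn]
      have p := hQ x (by omega)
      have f := hd (Q x) _ _ (pos_disj x x (fun _ _ => rfl))
      have : P (Q x) (pos (-x)) ↔ ¬ P (Q x) (pos x) := by tauto
      simp only [this, neg]
      split_ifs <;> omega
  · intro x hx
    have hc := (hs0 x hx).card_pos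
    by_cases h : (supp x).card ≤ 2 * r - 2
    · rw [hd1 x h]; omega
    · rw [hd2 x h]
      have : Q x < n := by
        rcases hQ x (by omega) with p | p <;> exact hPn _ _ p
      omega

end Fan

/-- `n` players with nonnegative monotonic subadditive utility functions on subsets of a set
of `m` items: there is a subset `T` of size at most `min(⌈(m+n−1)/2⌉, m) = min((m+n)/2, m)`
(ℕ-division) giving every player at least half of her utility for the whole set. -/
theorem stmt_16 {m n : ℕ} (f : Fin n → Finset (Fin m) → ℝ)
    (hnonneg : ∀ (i : Fin n) (A : Finset (Fin m)), 0 ≤ f i A)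
    (hmono : ∀ (i : Fin n) (A B : Finset (Fin m)), A ⊆ B → f i A ≤ f i B)
    (hsubadd : ∀ (i : Fin n) (A B : Finset (Fin m)), f i (A ∪ B) ≤ f i A + f i B) :
    ∃ T : Finset (Fin m), T.card ≤ min ((m + n) / 2) m ∧
      ∀ i : Fin n, (1 / 2) * f i Finset.univ ≤ f i T := by
  by_cases hnm : m ≤ n
  · refine ⟨Finset.univ, ?_, ?_⟩
    · simp only [Finset.card_univ, Fintype.card_fin]
      omega
    · intro i
      linarith [hnonneg i Finset.univ]
  by_contra hcon
  push Not at hcon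
  have := Fan.kneser (m := m) (n := n) (r := m - (m + n) / 2) (by omega)
    (fun i A => ∃ h : i < n, f ⟨i, h⟩ Aᶜ < (1 / 2) * f ⟨i, h⟩ Finset.univ) ?_ ?_ ?_
  · omega
  · intro A hA
    obtain ⟨i, hi⟩ := hcon Aᶜ (by
      rw [Finset.card_compl, Fintype.card_fin]
      omega)
    exact ⟨i.1, i.2, i.2, hi⟩
  · rintro i A ⟨h, _⟩
    exact h
  · rintro i A B hAB ⟨h, hA⟩ ⟨_, hB⟩
    have h1 := hsubadd ⟨i, h⟩ A Aᶜ
    rw [Finset.union_compl] at h1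
    have h2 := hmono ⟨i, h⟩ A Bᶜ (by
      intro a ha
      rw [Finset.mem_compl]
      exact Finset.disjoint_left.1 hAB ha)
    linarith
end
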